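/- Let f be a nice (deterministic, strategy-proof, bounded approximation ratio) mechanism for the two-facility game on a line with n ≥ 5 agents that admits a unique dictator j (so x_j ∈ f(x) for all x). Then for every profile x, writing f(x) = {x_j, l2}, either l2 ≥ max x, or l2 ≤ min x, or l2 = x_j. -/

import Mathlib

noncomputable def cost2 (p : ℝ × ℝ) (y : ℝ) : ℝ := min |p.1 - y| |p.2 - y|

noncomputable def SC {n : ℕ} (p : ℝ × ℝ) (x : Fin n → ℝ) : ℝ := ∑ i, cost2 p (x i)

noncomputable def OPT {n : ℕ} (x : Fin n → ℝ) : ℝ :=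
  sInf {c | ∃ l1 l2 : ℝ, c = SC (l1, l2) x}

def StrategyProof {n : ℕ} (f : (Fin n → ℝ) → ℝ × ℝ) : Prop :=
  ∀ (i : Fin n) (x : Fin n → ℝ) (x' : ℝ),
    cost2 (f x) (x i) ≤ cost2 (f (Function.update x i x')) (x i)

theorem cost2_nonneg (p : ℝ × ℝ) (y : ℝ) : 0 ≤ cost2 p y :=
  le_min (abs_nonneg _) (abs_nonneg _)

theorem SC_nonneg {n : ℕ} (p : ℝ × ℝ) (x : Fin n → ℝ) : 0 ≤ SC p x :=
  Finset.sum_nonneg fun _ _ => cost2_nonneg _ _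

theorem cost2_le_SC {n : ℕ} (p : ℝ × ℝ) (x : Fin n → ℝ) (i : Fin n) :
    cost2 p (x i) ≤ SC p x :=
  Finset.single_le_sum (f := fun i => cost2 p (x i)) (fun _ _ => cost2_nonneg _ _)
    (Finset.mem_univ i)

theorem OPT_nonneg {n : ℕ} (x : Fin n → ℝ) : 0 ≤ OPT x := by
  refine Real.sInf_nonneg ?_
  rintro c ⟨l1, l2, rfl⟩
  exact SC_nonneg _ _

theorem OPT_le_SC {n : ℕ} (p : ℝ × ℝ) (x : Fin n → ℝ) : OPT x ≤ SC p x := by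
  refine csInf_le ⟨0, ?_⟩ ⟨p.1, p.2, rfl⟩
  rintro c ⟨l1, l2, rfl⟩
  exact SC_nonneg _ _

/-- Agents sharing a common location cannot gain by a joint deviation. -/
theorem StrategyProof.cost2_le_piecewise {n : ℕ} {f : (Fin n → ℝ) → ℝ × ℝ}
    (hsp : StrategyProof f) (x x' : Fin n → ℝ) (t : ℝ) (S : Finset (Fin n))
    (hS : ∀ k ∈ S, x k = t) :
    cost2 (f x) t ≤ cost2 (f (S.piecewise x' x)) t := by
  induction S using Finset.induction_on with
  | empty => simp
  | insert s S hs ih =>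
    refine (ih fun k hk => hS k (Finset.mem_insert_of_mem hk)).trans ?_
    rw [Finset.piecewise_insert]
    have h := hsp s (S.piecewise x' x) (x' s)
    rwa [Finset.piecewise_eq_of_notMem _ _ _ hs, hS s (Finset.mem_insert_self _ _)] at h

/-- The facility of `p` that is not the one known to lie at `a`. -/
noncomputable def otherFacility (p : ℝ × ℝ) (a : ℝ) : ℝ := if p.1 = a then p.2 else p.1

theorem cost2_eq_min_otherFacility {p : ℝ × ℝ} {a : ℝ} (h : p.1 = a ∨ p.2 = a) (y : ℝ) :
    cost2 p y = min |a - y| |otherFacility p a - y| := by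
  unfold otherFacility cost2
  split_ifs with h1
  · rw [h1]
  · rw [h.resolve_left h1, min_comm]

theorem abs_sub_le_of_min_le {t z r : ℝ} (h : min |t| |z - t| ≤ r) (hr : r < |t|) :
    |z - t| ≤ r :=
  (min_le_iff.1 h).resolve_left hr.not_ge

/-- Two agents choose the location `l` of one facility while another one is fixed at `0`.
If the rule is strategy-proof and unanimous, it cannot put `l` at the location of the agent `b`
nearer to `0` unless it does so for arbitrarily far locations of the other agent. -/
theorem false_of_middle_served (l : ℝ → ℝ → ℝ)
    (hB : ∀ b b' c, min |b| |l b c - b| ≤ min |b| |l b' c - b|)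
    (hC : ∀ b c c', min |c| |l b c - c| ≤ min |c| |l b c' - c|)
    (hdiag : ∀ v, 0 < v → l v v = v) {b c₀ M : ℝ} (hb : 0 < b) (hc₀ : b < c₀)
    (hmid : l b c₀ = b) (hM : ∀ c, M < c → l b c ≠ b) : False := by
  have hB' : ∀ b b' c r, 0 < b → |l b' c - b| ≤ r → r < b → |l b c - b| ≤ r := by
    intro b b' c r hb h hr
    exact abs_sub_le_of_min_le ((hB b b' c).trans (min_le_of_right_le h)) (by rwa [abs_of_pos hb])
  have hC' : ∀ b c c' r, 0 < c → |l b c' - c| ≤ r → r < c → |l b c - c| ≤ r := by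
    intro b c c' r hc h hr
    exact abs_sub_le_of_min_le ((hC b c c').trans (min_le_of_right_le h)) (by rwa [abs_of_pos hc])
  obtain ⟨δ, hδ, hδb, hδc⟩ : ∃ δ : ℝ, 0 < δ ∧ δ ≤ b / 16 ∧ δ ≤ (c₀ - b) / 2 :=
    ⟨min (b / 16) ((c₀ - b) / 2), lt_min (by linarith) (by linarith), min_le_left _ _,
      min_le_right _ _⟩
  obtain ⟨u, v, huv, hu, hlu, hlv⟩ :
      ∃ u v : ℝ, v = u + δ ∧ c₀ ≤ u ∧ l b u = b ∧ l b v ≠ b := by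
    have hbdd : BddAbove {c | c₀ ≤ c ∧ l b c = b} :=
      ⟨M, fun c hc => not_lt.1 fun h => hM c h hc.2⟩
    obtain ⟨u, hu, hsu⟩ := exists_lt_of_lt_csSup
      (⟨c₀, le_rfl, hmid⟩ : {c | c₀ ≤ c ∧ l b c = b}.Nonempty)
      (sub_lt_self (sSup {c | c₀ ≤ c ∧ l b c = b}) hδ)
    refine ⟨u, u + δ, rfl, hu.1, hu.2, fun h => ?_⟩
    have := le_csSup hbdd (show u + δ ∈ {c | c₀ ≤ c ∧ l b c = b} from ⟨by linarith [hu.1], h⟩)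
    linarith
  -- The option set of the second agent has a hole from `b` to about `2 * u - b`.
  have hw : 2 * u - b ≤ l b v := by
    have h1 := hC' b v u (v - b) (by linarith)
      (by rw [hlu, abs_le]; constructor <;> linarith) (by linarith)
    rw [abs_le] at h1
    have hbw : b < l b v := lt_of_le_of_ne (by linarith) (Ne.symm hlv)
    by_contra! hlt
    have h2 := hC' b u v (max (l b v - u) (u - l b v)) (by linarith)
      (by rw [abs_eq_max_neg, neg_sub]) (max_lt (by linarith) (by linarith))
    have h3 : max (l b v - u) (u - l b v) < u - b := max_lt (by linarith) (by linarith)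
    rw [hlu, abs_le] at h2
    linarith
  -- Hence the first agent, when at `b`, is not served, and has no better options.
  have hgap : ∀ y, 0 < l y v → 2 * b ≤ l y v := by
    have key : ∀ y, |l y v - b| < b → 2 * u - 2 * b ≤ |l y v - b| := by
      intro y hy
      have h := hB' b y v _ hb le_rfl hy
      linarith [le_abs_self (l b v - b)]
    have hv : 2 * b ≤ v := by
      by_contra! hlt
      have h := key v
      rw [hdiag v (by linarith), abs_of_pos (by linarith)] at h
      linarith [h (by linarith)]
    intro y hy
    by_contra! hlt
    have h1 : |l y v - b| < b := by rw [abs_lt]; constructor <;> linarith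
    linarith [key y h1]
  obtain ⟨e, ⟨y, hye⟩, he, hev, hmin⟩ : ∃ e, (∃ y, l y v = e) ∧ 0 < e ∧ e ≤ v + b / 16 ∧
      ∀ y, 0 < l y v → e - b / 16 ≤ l y v := by
    have hbdd : BddBelow {z | 0 < z ∧ ∃ y, l y v = z} := ⟨0, fun z hz => hz.1.le⟩
    have hv : v ∈ {z | 0 < z ∧ ∃ y, l y v = z} :=
      ⟨by linarith, v, hdiag v (by linarith)⟩
    obtain ⟨e, he, hlt⟩ := exists_lt_of_csInf_lt ⟨v, hv⟩
      (lt_add_of_pos_right (sInf {z | 0 < z ∧ ∃ y, l y v = z}) (show 0 < b / 16 by linarith))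
    refine ⟨e, he.2, he.1, by linarith [csInf_le hbdd hv], fun y hy => ?_⟩
    linarith [csInf_le hbdd (show l y v ∈ {z | 0 < z ∧ ∃ y, l y v = z} from ⟨hy, y, rfl⟩)]
  have he2 : 2 * b ≤ e := hye ▸ hgap y (hye ▸ he)
  -- An agent slightly to the right of `e / 2` separates the outcomes at `u` and `v`.
  have hz := hB' (e / 2 + b / 4) y v (e / 2 - b / 4) (by linarith)
    (by rw [hye, abs_le]; constructor <;> linarith) (by linarith)
  rw [abs_le] at hz
  have hz' := hmin (e / 2 + b / 4) (by linarith)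
  have hq := hB' (e / 2 + b / 4) b u (e / 2 - 3 * b / 4) (by linarith)
    (by rw [hlu, abs_le]; constructor <;> linarith) (by linarith)
  rw [abs_le] at hq
  have hr := hC' (e / 2 + b / 4) u v (max (u - e + b / 16) (b / 8)) (by linarith)
    (by
      rw [abs_sub_le_iff]
      exact ⟨le_max_of_le_right (by linarith), le_max_of_le_left (by linarith)⟩)
    (max_lt (by linarith) (by linarith))
  have hlt : max (u - e + b / 16) (b / 8) < u - e + b / 2 := max_lt (by linarith) (by linarith)
  rw [abs_le] at hr
  linarith

/-- The profile with agent `j` at `a`, agent `i ≠ j` at `c`, and everybody else at `b`. -/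
def threeProfile {n : ℕ} (j i : Fin n) (a b c : ℝ) : Fin n → ℝ :=
  fun k => if k = j then a else if k = i then c else b

/-- The location, in the coordinate with origin `a` and orientation `σ`, of the facility
not at agent `j` on a three-location profile. -/
noncomputable def relativeFacility {n : ℕ} (f : (Fin n → ℝ) → ℝ × ℝ) (j i : Fin n)
    (a σ b c : ℝ) : ℝ :=
  σ * (otherFacility (f (threeProfile j i a (a + σ * b) (a + σ * c))) a - a)

section

variable {n : ℕ} {f : (Fin n → ℝ) → ℝ × ℝ} {j i : Fin n} {a σ : ℝ}

theorem cost2_threeProfile (hdict : ∀ x : Fin n → ℝ, (f x).1 = x j ∨ (f x).2 = x j)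
    (hσ : σ * σ = 1) (b c t : ℝ) :
    cost2 (f (threeProfile j i a (a + σ * b) (a + σ * c))) (a + σ * t) =
      min |t| |relativeFacility f j i a σ b c - t| := by
  have habs : |σ| = 1 := by rcases mul_self_eq_one_iff.1 hσ with rfl | rfl <;> simp
  have h := hdict (threeProfile j i a (a + σ * b) (a + σ * c))
  rw [show threeProfile j i a (a + σ * b) (a + σ * c) j = a by simp [threeProfile]] at h
  rw [cost2_eq_min_otherFacility h, relativeFacility]
  set q := otherFacility (f (threeProfile j i a (a + σ * b) (a + σ * c))) a
  congr 1
  · rw [show a - (a + σ * t) = -(σ * t) by ring, abs_neg, abs_mul, habs, one_mul]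
  · rw [show σ * (q - a) - t = σ * (q - (a + σ * t)) by linear_combination t * hσ,
      abs_mul, habs, one_mul]

theorem relativeFacility_eq_of_cost2 (hdict : ∀ x : Fin n → ℝ, (f x).1 = x j ∨ (f x).2 = x j)
    (hσ : σ * σ = 1) {b c t : ℝ} (ht : 0 < t)
    (h : cost2 (f (threeProfile j i a (a + σ * b) (a + σ * c))) (a + σ * t) ≤ 0) :
    relativeFacility f j i a σ b c = t := by
  rw [cost2_threeProfile hdict hσ] at h
  have := abs_sub_le_of_min_le h (abs_pos.2 ht.ne')
  exact sub_eq_zero.1 (abs_nonpos_iff.1 this)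

/-- A dictatorial nice mechanism places no facility strictly between the dictator and
another agent, as seen in the orientation `σ`. -/
theorem not_strictly_between (hsp : StrategyProof f)
    (hbounded : ∃ γ : ℝ, ∀ x : Fin n → ℝ, SC (f x) x ≤ γ * OPT x)
    (hdict : ∀ x : Fin n → ℝ, (f x).1 = x j ∨ (f x).2 = x j) (hσ : σ * σ = 1)
    {x : Fin n → ℝ} {l : ℝ} (hl : l = (f x).1 ∨ l = (f x).2)
    (hjl : 0 < σ * (l - x j)) (hli : 0 < σ * (x i - l)) : False := by
  obtain ⟨γ, hγ⟩ := hbounded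
  have hij : i ≠ j := by
    rintro rfl
    linarith [show σ * (l - x i) + σ * (x i - l) = 0 by ring]
  have hPi : ∀ a b c, threeProfile j i a b c i = c := by simp [threeProfile, hij]
  have hgroup : ∀ k ∈ ({j, i}ᶜ : Finset (Fin n)), k ≠ j ∧ k ≠ i := by simp
  set a := x j with ha
  refine false_of_middle_served (relativeFacility f j i a σ) ?_ ?_ ?_
    (b := σ * (l - a)) (c₀ := σ * (x i - a))
    (M := |γ| * (n * (σ * (l - a))) + σ * (l - a)) hjl ?_ ?_ ?_
  · intro b b' c
    rw [← cost2_threeProfile hdict hσ, ← cost2_threeProfile hdict hσ]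
    convert hsp.cost2_le_piecewise (threeProfile j i a (a + σ * b) (a + σ * c))
      (threeProfile j i a (a + σ * b') (a + σ * c)) (a + σ * b) {j, i}ᶜ ?_ using 3
    · ext m
      by_cases hmj : m = j
      · simp [threeProfile, hmj, Finset.piecewise]
      · by_cases hmi : m = i <;> simp [threeProfile, hmj, hmi, Finset.piecewise]
    · intro m hm
      simp [threeProfile, hgroup m hm]
  · intro b c c'
    rw [← cost2_threeProfile hdict hσ, ← cost2_threeProfile hdict hσ]
    convert hsp i (threeProfile j i a (a + σ * b) (a + σ * c)) (a + σ * c') using 3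
    · exact (hPi _ _ _).symm
    · ext m
      by_cases hmi : m = i
      · subst hmi; simp [hPi]
      · simp [threeProfile, hmi]
    · exact (hPi _ _ _).symm
  · intro v hv
    refine relativeFacility_eq_of_cost2 hdict hσ hv ?_
    set y := threeProfile j i a (a + σ * v) (a + σ * v) with hy
    have hOPT : OPT y = 0 := by
      refine le_antisymm ((OPT_le_SC (a, a + σ * v) y).trans_eq ?_) (OPT_nonneg y)
      refine Finset.sum_eq_zero fun m _ => ?_
      by_cases hmj : m = j <;> simp [hy, threeProfile, cost2, hmj, mul_nonneg]
    have h := (cost2_le_SC (f y) y i).trans (hγ y)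
    rwa [hOPT, mul_zero, hy, hPi, ← hy] at h
  · linarith [show σ * (x i - a) - σ * (l - a) = σ * (x i - l) by ring]
  · refine relativeFacility_eq_of_cost2 hdict hσ hjl ?_
    have e1 : a + σ * (σ * (l - a)) = l := by linear_combination (l - a) * hσ
    have e2 : a + σ * (σ * (x i - a)) = x i := by linear_combination (x i - a) * hσ
    rw [e1, e2]
    have h := hsp.cost2_le_piecewise (threeProfile j i a l (x i)) x l {j, i}ᶜ
      fun m hm => by simp [threeProfile, hgroup m hm]
    rw [show Finset.piecewise {j, i}ᶜ x (threeProfile j i a l (x i)) = x by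
      ext m
      by_cases hmj : m = j
      · simp [threeProfile, hmj, Finset.piecewise, ha]
      · by_cases hmi : m = i <;> simp [threeProfile, hmj, hmi, hij, Finset.piecewise]] at h
    refine h.trans ?_
    rcases hl with hl | hl <;> simp [cost2, hl]
  · intro c hc heq
    have e1 : a + σ * (σ * (l - a)) = l := by linear_combination (l - a) * hσ
    have hcost := cost2_threeProfile (i := i) (a := a) hdict hσ (σ * (l - a)) c c
    rw [heq, e1] at hcost
    set y := threeProfile j i a l (a + σ * c) with hy
    have hOPT : OPT y ≤ n * (σ * (l - a)) := by
      have habs : σ * (l - a) = |a - l| := by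
        rw [← abs_of_pos hjl, abs_mul, abs_sub_comm]
        rcases mul_self_eq_one_iff.1 hσ with rfl | rfl <;> simp
      refine (OPT_le_SC (a, a + σ * c) y).trans ?_
      refine (Finset.sum_le_card_nsmul _ _ (σ * (l - a)) fun m _ => ?_).trans_eq (by simp)
      by_cases hmj : m = j
      · exact (min_le_left _ _).trans (by simpa [hy, threeProfile, hmj] using hjl.le)
      · by_cases hmi : m = i
        · exact (min_le_right _ _).trans (by simpa [hy, threeProfile, hmi, hij] using hjl.le)
        · exact (min_le_left _ _).trans (by simp [hy, threeProfile, hmj, hmi, habs])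
    have hSC := (cost2_le_SC (f y) y i).trans ((hγ y).trans
      (mul_le_mul (le_abs_self γ) hOPT (OPT_nonneg y) (abs_nonneg γ)))
    rw [show y i = a + σ * c from hPi _ _ _, hcost] at hSC
    have hpos : 0 ≤ |γ| * (n * (σ * (l - a))) := by positivity
    rcases min_le_iff.1 hSC with h | h
    · linarith [le_abs_self c]
    · linarith [neg_abs_le (σ * (l - a) - c)]

end

/-- If `f` is a nice (deterministic, strategy-proof, bounded-approximation)
mechanism for `n ≥ 5` agents with a unique dictator `j` (i.e. `x_j ∈ f(x)` always),
then on every profile every output facility `l` satisfies `l ≥ max x`, or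
`l ≤ min x`, or `l = x_j`. -/
theorem stmt18 {n : ℕ} (hn : 5 ≤ n) (f : (Fin n → ℝ) → ℝ × ℝ)
    (hsp : StrategyProof f)
    (hbounded : ∃ γ : ℝ, ∀ x : Fin n → ℝ, SC (f x) x ≤ γ * OPT x)
    (j : Fin n) (hdict : ∀ x : Fin n → ℝ, (f x).1 = x j ∨ (f x).2 = x j) :
    ∀ (x : Fin n → ℝ) (l : ℝ), (l = (f x).1 ∨ l = (f x).2) →
      (∀ i, x i ≤ l) ∨ (∀ i, l ≤ x i) ∨ l = x j := by
  intro x l hl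
  by_contra! h
  obtain ⟨⟨i, hi⟩, ⟨k, hk⟩, hne⟩ := h
  rcases lt_or_gt_of_ne hne with hlt | hgt
  · exact not_strictly_between (i := k) (σ := -1) hsp hbounded hdict (by norm_num) hl
      (by linarith) (by linarith)
  · exact not_strictly_between (i := i) (σ := 1) hsp hbounded hdict (by norm_num) hl
      (by linarith) (by linarith)
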